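/- Let H_A = C^2 and H_B = H_C = C^4 with orthonormal bases {|0⟩,|1⟩} and {|0⟩,|1⟩,|2⟩,|3⟩} respectively. Fix real parameters λ1, b, β2 ∈ [0,1], set a = √(1−b²), α2 = √(1−β2²), |φ_B⟩ = a|1_B⟩ + b|2_B⟩, |ψ¹_A⟩ = (|0_A⟩+|1_A⟩)/√2, |ψ²_AB⟩ = α2|0_A 0_B⟩ + β2|1_A φ_B⟩, ϱ¹_BC = λ1|2_B 2_C⟩⟨2_B 2_C| + (1−λ1)|3_B 3_C⟩⟨3_B 3_C|, ϱ²_C = (1/2)|0_C⟩⟨0_C| + (1/2)|1_C⟩⟨1_C|, and ρ_ABC = (1/2)|ψ¹_A⟩⟨ψ¹_A| ⊗ ϱ¹_BC + (1/2)|ψ²_AB⟩⟨ψ²_AB| ⊗ ϱ²_C. Then T^(a)(ρ_ABC) = 0 if and only if λ1 · b · β2 = 0. -/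

import Mathlib

open Matrix Kronecker
open scoped Classical ComplexOrder

noncomputable section

/-- A state (density operator): positive semidefinite with unit trace. -/
def IsState {n : Type*} [Fintype n] (ρ : Matrix n n ℂ) : Prop :=
  ρ.PosSemidef ∧ ρ.trace = 1

/-- A unit vector. -/
def UnitVec {n : Type*} [Fintype n] (ψ : n → ℂ) : Prop :=
  ∑ i, Complex.normSq (ψ i) = 1

/-- The rank-one projection `|ψ⟩⟨ψ|`. -/
def pureSt {n : Type*} (ψ : n → ℂ) : Matrix n n ℂ :=
  Matrix.vecMulVec ψ (star ψ)

/-- Von Neumann entropy `S(ρ) = -Tr(ρ log ρ)`, computed via the eigenvalues of a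
Hermitian matrix (with the convention `0 log 0 = 0`, and junk value `0` on
non-Hermitian input). -/
def entropy {n : Type*} [Fintype n] [DecidableEq n] (ρ : Matrix n n ℂ) : ℝ :=
  if h : ρ.IsHermitian then -∑ i, h.eigenvalues i * Real.log (h.eigenvalues i) else 0

/-- Partial trace over the second tensor factor. -/
def ptraceRight {X Y : Type*} [Fintype Y] (ρ : Matrix (X × Y) (X × Y) ℂ) :
    Matrix X X ℂ :=
  fun x x' => ∑ y, ρ (x, y) (x', y)

/-- Partial trace over the first tensor factor. -/
def ptraceLeft {X Y : Type*} [Fintype X] (ρ : Matrix (X × Y) (X × Y) ℂ) :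
    Matrix Y Y ℂ :=
  fun y y' => ∑ x, ρ (x, y) (x, y')

/-- Marginal `ρ_AB` of a tripartite state. -/
def margAB {A B C : Type*} [Fintype C] (ρ : Matrix (A × B × C) (A × B × C) ℂ) :
    Matrix (A × B) (A × B) ℂ :=
  fun x y => ∑ c, ρ (x.1, x.2, c) (y.1, y.2, c)

/-- Marginal `ρ_AC` of a tripartite state. -/
def margAC {A B C : Type*} [Fintype B] (ρ : Matrix (A × B × C) (A × B × C) ℂ) :
    Matrix (A × C) (A × C) ℂ :=
  fun x y => ∑ b, ρ (x.1, b, x.2) (y.1, b, y.2)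

/-- Marginal `ρ_BC` of a tripartite state. -/
def margBC {A B C : Type*} [Fintype A] (ρ : Matrix (A × B × C) (A × B × C) ℂ) :
    Matrix (B × C) (B × C) ℂ :=
  fun x y => ∑ a, ρ (a, x.1, x.2) (a, y.1, y.2)

/-- Marginal `ρ_A` of a tripartite state. -/
def margA {A B C : Type*} [Fintype B] [Fintype C]
    (ρ : Matrix (A × B × C) (A × B × C) ℂ) : Matrix A A ℂ :=
  fun a a' => ∑ b, ∑ c, ρ (a, b, c) (a', b, c)

/-- Marginal `ρ_B` of a tripartite state. -/
def margB {A B C : Type*} [Fintype A] [Fintype C]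
    (ρ : Matrix (A × B × C) (A × B × C) ℂ) : Matrix B B ℂ :=
  fun b b' => ∑ a, ∑ c, ρ (a, b, c) (a, b', c)

/-- Marginal `ρ_C` of a tripartite state. -/
def margC {A B C : Type*} [Fintype A] [Fintype B]
    (ρ : Matrix (A × B × C) (A × B × C) ℂ) : Matrix C C ℂ :=
  fun c c' => ∑ a, ∑ b, ρ (a, b, c) (a, b, c')

/-- `T^(a)(ρ_ABC) = S(ρ_AB) + S(ρ_AC) − S(ρ_B) − S(ρ_C)`, the deviation from
saturation of strong subadditivity. -/
def Ta {A B C : Type*} [Fintype A] [Fintype B] [Fintype C]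
    [DecidableEq A] [DecidableEq B] [DecidableEq C]
    (ρ : Matrix (A × B × C) (A × B × C) ℂ) : ℝ :=
  entropy (margAB ρ) + entropy (margAC ρ) - entropy (margB ρ) - entropy (margC ρ)

/-- Entanglement of formation of a bipartite state (infimum over pure-state
ensembles realizing `ρ`). -/
def eof {X Y : Type*} [Fintype X] [Fintype Y] [DecidableEq X]
    (ρ : Matrix (X × Y) (X × Y) ℂ) : ℝ :=
  sInf { e : ℝ | ∃ (K : ℕ) (p : Fin K → ℝ) (ψ : Fin K → X × Y → ℂ),
    (∀ i, 0 ≤ p i) ∧ (∀ i, UnitVec (ψ i)) ∧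
    ρ = ∑ i, p i • pureSt (ψ i) ∧
    e = ∑ i, p i * entropy (ptraceRight (pureSt (ψ i))) }

/-- Probability of obtaining the outcome of the rank-one projector `|u⟩⟨u|`
measured on the second subsystem. -/
def measProb {X Y : Type*} [Fintype X] [Fintype Y] [DecidableEq X]
    (ρ : Matrix (X × Y) (X × Y) ℂ) (u : Y → ℂ) : ℝ :=
  ((((1 : Matrix X X ℂ) ⊗ₖ pureSt u) * ρ).trace).re

/-- Post-measurement state of the first subsystem after obtaining the outcome
of the rank-one projector `|u⟩⟨u|` on the second subsystem. -/
def postState {X Y : Type*} [Fintype X] [Fintype Y] [DecidableEq X]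
    (ρ : Matrix (X × Y) (X × Y) ℂ) (u : Y → ℂ) : Matrix X X ℂ :=
  (measProb ρ u)⁻¹ •
    ptraceRight (((1 : Matrix X X ℂ) ⊗ₖ pureSt u) * ρ * ((1 : Matrix X X ℂ) ⊗ₖ pureSt u))

/-- Classical correlation `J^(Y)(ρ_XY)`: supremum over complete families of
mutually orthogonal rank-one projectors on `H_Y` (parametrized by orthonormal
bases `v` of `H_Y`) of `S(ρ_X) − ∑ᵢ pᵢ S(ρ_{X|i})`. -/
def classicalCorr {X Y : Type*} [Fintype X] [Fintype Y] [DecidableEq X] [DecidableEq Y]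
    (ρ : Matrix (X × Y) (X × Y) ℂ) : ℝ :=
  sSup { r : ℝ | ∃ v : Y → Y → ℂ,
    (∀ i j, star (v i) ⬝ᵥ v j = if i = j then 1 else 0) ∧
    r = entropy (ptraceRight ρ) - ∑ i, measProb ρ (v i) * entropy (postState ρ (v i)) }

/-- Quantum mutual information `I(ρ_XY) = S(ρ_X) + S(ρ_Y) − S(ρ_XY)`. -/
def mutualInfo {X Y : Type*} [Fintype X] [Fintype Y] [DecidableEq X] [DecidableEq Y]
    (ρ : Matrix (X × Y) (X × Y) ℂ) : ℝ :=
  entropy (ptraceRight ρ) + entropy (ptraceLeft ρ) - entropy ρ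

/-- Quantum discord `D^(Y)(ρ_XY)` with measurement on the second subsystem. -/
def discord {X Y : Type*} [Fintype X] [Fintype Y] [DecidableEq X] [DecidableEq Y]
    (ρ : Matrix (X × Y) (X × Y) ℂ) : ℝ :=
  mutualInfo ρ - classicalCorr ρ

/-- Quantum conditional entropy `S(X|Y) = S(ρ_XY) − S(ρ_Y)`. -/
def condEnt {X Y : Type*} [Fintype X] [Fintype Y] [DecidableEq X] [DecidableEq Y]
    (ρ : Matrix (X × Y) (X × Y) ℂ) : ℝ :=
  entropy ρ - entropy (ptraceLeft ρ)

/-- Marginal `ρ_{AB̃}` (`B̃ = BE`) of a four-partite state on `A × B × C × E`. -/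
def margABE {A B C E : Type*} [Fintype C]
    (Ψ : Matrix (A × B × C × E) (A × B × C × E) ℂ) :
    Matrix (A × B × E) (A × B × E) ℂ :=
  fun x y => ∑ c, Ψ (x.1, x.2.1, c, x.2.2) (y.1, y.2.1, c, y.2.2)

/-- Marginal `ρ_{AC̃}` (`C̃ = CE`) of a four-partite state on `A × B × C × E`. -/
def margACE {A B C E : Type*} [Fintype B]
    (Ψ : Matrix (A × B × C × E) (A × B × C × E) ℂ) :
    Matrix (A × C × E) (A × C × E) ℂ :=
  fun x y => ∑ b, Ψ (x.1, b, x.2.1, x.2.2) (y.1, b, y.2.1, y.2.2)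

/-- Marginal `ρ_ABC` of a four-partite state on `A × B × C × E` (trace out `E`). -/
def margABC {A B C E : Type*} [Fintype E]
    (Ψ : Matrix (A × B × C × E) (A × B × C × E) ℂ) :
    Matrix (A × B × C) (A × B × C) ℂ :=
  fun x y => ∑ e, Ψ (x.1, x.2.1, x.2.2, e) (y.1, y.2.1, y.2.2, e)

/-- Reordering `(A ⊗ (B^L ⊗ C^L)) ⊗ (B^R ⊗ C^R) ≃ A ⊗ (B^L ⊗ B^R) ⊗ (C^L ⊗ C^R)`. -/
def reindexYZ (A BL BR CL CR : Type*) :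
    (A × (BL × CL)) × (BR × CR) ≃ A × (BL × BR) × (CL × CR) where
  toFun x := (x.1.1, (x.1.2.1, x.2.1), (x.1.2.2, x.2.2))
  invFun x := ((x.1, (x.2.1.1, x.2.2.1)), (x.2.1.2, x.2.2.2))
  left_inv := by rintro ⟨⟨a, bl, cl⟩, br, cr⟩; rfl
  right_inv := by rintro ⟨a, ⟨bl, br⟩, cl, cr⟩; rfl


/-- `|ψ¹_A⟩ = (|0_A⟩ + |1_A⟩)/√2` (i.e. `α₁ = β₁ = 1/√2`). -/
def psi1 : Fin 2 → ℂ := fun _ => ((Real.sqrt 2 : ℂ))⁻¹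

/-- `|φ_B⟩ = a|1_B⟩ + b|2_B⟩` with `a = √(1 − b²)`. -/
def phiB (b : ℝ) : Fin 4 → ℂ := fun j =>
  if j = 1 then (Real.sqrt (1 - b ^ 2) : ℂ) else if j = 2 then (b : ℂ) else 0

/-- `|ψ²_AB⟩ = α₂|0_A 0_B⟩ + β₂|1_A φ_B⟩` with `α₂ = √(1 − β₂²)`. -/
def psi2 (b β₂ : ℝ) : Fin 2 × Fin 4 → ℂ := fun x =>
  if x.1 = 0 then (if x.2 = 0 then (Real.sqrt (1 - β₂ ^ 2) : ℂ) else 0)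
  else (β₂ : ℂ) * phiB b x.2

/-- `ϱ¹_BC = λ₁|2_B 2_C⟩⟨2_B 2_C| + (1 − λ₁)|3_B 3_C⟩⟨3_B 3_C|`. -/
def rho1BC (lam₁ : ℝ) : Matrix (Fin 4 × Fin 4) (Fin 4 × Fin 4) ℂ := fun x y =>
  if x = (2, 2) ∧ y = (2, 2) then (lam₁ : ℂ)
  else if x = (3, 3) ∧ y = (3, 3) then ((1 - lam₁ : ℝ) : ℂ) else 0

/-- `ϱ²_C = (1/2)|0_C⟩⟨0_C| + (1/2)|1_C⟩⟨1_C|` (i.e. `λ₂ = 1/2`). -/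
def rho2C : Matrix (Fin 4) (Fin 4) ℂ := fun c c' =>
  if c = c' ∧ (c = 0 ∨ c = 1) then (1 / 2 : ℂ) else 0

/-- `ρ_ABC = (1/2)|ψ¹_A⟩⟨ψ¹_A| ⊗ ϱ¹_BC + (1/2)|ψ²_AB⟩⟨ψ²_AB| ⊗ ϱ²_C`
(i.e. `p₁ = p₂ = 1/2`), on `H_A ⊗ H_B ⊗ H_C = ℂ² ⊗ ℂ⁴ ⊗ ℂ⁴`. -/
def exampleRho (lam₁ b β₂ : ℝ) :
    Matrix (Fin 2 × Fin 4 × Fin 4) (Fin 2 × Fin 4 × Fin 4) ℂ :=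
  (1 / 2 : ℝ) • (pureSt psi1 ⊗ₖ rho1BC lam₁) +
  (1 / 2 : ℝ) • ((pureSt (psi2 b β₂) ⊗ₖ rho2C).submatrix
      ⇑(Equiv.prodAssoc (Fin 2) (Fin 4) (Fin 4)).symm
      ⇑(Equiv.prodAssoc (Fin 2) (Fin 4) (Fin 4)).symm)

section RealAnalysis

open Real Filter Topology Set

theorem tendsto_add_mul_log_add_sub (x : ℝ) :
    Tendsto (fun u : ℝ => (u + x) * log (u + x) - (u + x) * log u) atTop (𝓝 x) := by
  have h1 : Tendsto (fun u : ℝ => u * log (1 + x / u)) atTop (𝓝 x) :=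
    tendsto_mul_log_one_add_div_atTop x
  have h2 : Tendsto (fun u : ℝ => log (1 + x / u)) atTop (𝓝 0) := by
    have h : Tendsto (fun u : ℝ => 1 + x / u) atTop (𝓝 (1 + 0)) :=
      tendsto_const_nhds.add (tendsto_const_nhds.div_atTop tendsto_id)
    have h' := h.log (by norm_num)
    simpa using h'
  have h3 := h1.add (h2.const_mul x)
  rw [mul_zero, add_zero] at h3
  refine h3.congr' ?_
  filter_upwards [eventually_gt_atTop 0, eventually_gt_atTop (-x)] with u hu hux
  have : 1 + x / u = (u + x) / u := by field_simp
  rw [this, log_div (by linarith) hu.ne']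
  ring

/-- If two families of nonnegative reals have the same sum, the one whose shifted products are
larger has the larger entropy. -/
theorem sum_negMulLog_lt_of_prod_add_lt {ι : Type*} [Fintype ι] {x y : ι → ℝ}
    (hx : ∀ i, 0 ≤ x i) (hy : ∀ i, 0 ≤ y i) (hsum : ∑ i, x i = ∑ i, y i)
    (hprod : ∀ u : ℝ, 0 < u → ∏ i, (u + y i) < ∏ i, (u + x i)) :
    ∑ i, negMulLog (y i) < ∑ i, negMulLog (x i) := by
  set φ : ℝ → ℝ := fun u =>
    ∑ i, ((u + x i) * log (u + x i)) - ∑ i, ((u + y i) * log (u + y i)) with hφ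
  have hcont : Continuous φ := by
    have h (z : ℝ) : Continuous fun u : ℝ => (u + z) * log (u + z) :=
      continuous_mul_log.comp (continuous_id.add continuous_const)
    exact (continuous_finsetSum _ fun i _ => h (x i)).sub
      (continuous_finsetSum _ fun i _ => h (y i))
  have hderiv (u : ℝ) (hu : 0 < u) :
      HasDerivAt φ (∑ i, (log (u + x i) + 1) - ∑ i, (log (u + y i) + 1)) u := by
    have h (z : ℝ) (hz : 0 ≤ z) :
        HasDerivAt (fun u : ℝ => (u + z) * log (u + z)) (log (u + z) + 1) u := by
      have := (hasDerivAt_mul_log (x := u + z) (by positivity)).comp_add_const u z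
      exact this
    exact (HasDerivAt.fun_sum fun i _ => h (x i) (hx i)).sub
      (HasDerivAt.fun_sum fun i _ => h (y i) (hy i))
  have hmono : StrictMonoOn φ (Ici 0) := by
    refine strictMonoOn_of_deriv_pos (convex_Ici 0) hcont.continuousOn fun u hu => ?_
    rw [interior_Ici, mem_Ioi] at hu
    have hxu (i : ι) : 0 < u + x i := add_pos_of_pos_of_nonneg hu (hx i)
    have hyu (i : ι) : 0 < u + y i := add_pos_of_pos_of_nonneg hu (hy i)
    rw [(hderiv u hu).deriv, Finset.sum_add_distrib, Finset.sum_add_distrib,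
      ← log_prod (fun i _ => (hxu i).ne'), ← log_prod (fun i _ => (hyu i).ne')]
    have := log_lt_log (Finset.prod_pos fun i _ => hyu i) (hprod u hu)
    linarith
  have hlim : Tendsto φ atTop (𝓝 0) := by
    have h := (tendsto_finsetSum Finset.univ fun i _ => tendsto_add_mul_log_add_sub (x i)).sub
      (tendsto_finsetSum Finset.univ fun i _ => tendsto_add_mul_log_add_sub (y i))
    rw [hsum, sub_self] at h
    refine h.congr fun u => ?_
    have hu : ∑ i, (u + x i) * log u = ∑ i, (u + y i) * log u := by
      rw [← Finset.sum_mul, ← Finset.sum_mul, Finset.sum_add_distrib, Finset.sum_add_distrib, hsum]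
    simp only [hφ, Finset.sum_sub_distrib, hu]
    ring
  have h01 : φ 0 < φ 1 := hmono (by simp) (by simp) one_pos
  have h1 : φ 1 ≤ 0 := by
    refine ge_of_tendsto hlim ?_
    filter_upwards [eventually_ge_atTop 1] with u hu
    exact hmono.monotoneOn (by simp) (by simp; linarith) hu
  have h0 : φ 0 = ∑ i, negMulLog (y i) - ∑ i, negMulLog (x i) := by
    simp only [hφ, zero_add, negMulLog, neg_mul, Finset.sum_neg_distrib]
    ring
  linarith

theorem apply_add_apply_eq_of_add_eq_of_mul_eq (f : ℝ → ℝ) {x₁ x₂ p q : ℝ}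
    (hadd : x₁ + x₂ = p + q) (hmul : x₁ * x₂ = p * q) : f x₁ + f x₂ = f p + f q := by
  have h : (x₁ - p) * (x₁ - q) = 0 := by linear_combination x₁ * hadd - hmul
  rcases mul_eq_zero.mp h with h | h
  · rw [sub_eq_zero.mp h, show x₂ = q by linarith]
  · rw [sub_eq_zero.mp h, show x₂ = p by linarith, add_comm]

theorem exists_nonneg_add_eq_mul_eq {t d : ℝ} (ht : 0 ≤ t) (hd : 0 ≤ d) (htd : 4 * d ≤ t ^ 2) :
    ∃ x₁ x₂ : ℝ, 0 ≤ x₁ ∧ 0 ≤ x₂ ∧ x₁ + x₂ = t ∧ x₁ * x₂ = d := by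
  have hs : √(t ^ 2 - 4 * d) ^ 2 = t ^ 2 - 4 * d := sq_sqrt (by linarith)
  have hle : √(t ^ 2 - 4 * d) ≤ t := sqrt_le_iff.mpr ⟨ht, by linarith⟩
  refine ⟨(t + √(t ^ 2 - 4 * d)) / 2, (t - √(t ^ 2 - 4 * d)) / 2, by positivity, by linarith,
    by ring, by linear_combination -hs / 4⟩

theorem negMulLog_div_two (x : ℝ) : negMulLog (x / 2) = negMulLog x / 2 + x * (log 2 / 2) := by
  have h : negMulLog (2⁻¹ : ℝ) = log 2 / 2 := by
    rw [negMulLog, log_inv]; ring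
  rw [div_eq_mul_inv, negMulLog_mul, h]; ring

theorem entropy_balance_iff {l s b x₁ x₂ y₁ y₂ : ℝ} (hl : 0 ≤ l) (hs : 0 ≤ s) (hs1 : s ≤ 1)
    (hx₁ : 0 ≤ x₁) (hx₂ : 0 ≤ x₂) (hy₁ : 0 ≤ y₁) (hy₂ : 0 ≤ y₂)
    (hxa : x₁ + x₂ = 1 + l) (hxm : x₁ * x₂ = l * (1 - s * b ^ 2 / 2))
    (hya : y₁ + y₂ = l + s) (hym : y₁ * y₂ = l * s * (1 - b ^ 2)) :
    negMulLog x₁ + negMulLog x₂ + negMulLog s - (negMulLog y₁ + negMulLog y₂) = 0 ↔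
      l * s * b ^ 2 = 0 := by
  refine ⟨fun h => ?_, fun h => ?_⟩
  · by_contra hc
    have hc : 0 < l * s * b ^ 2 := lt_of_le_of_ne (by positivity) (Ne.symm hc)
    have key := sum_negMulLog_lt_of_prod_add_lt (x := ![x₁, x₂, s]) (y := ![y₁, y₂, 1])
      (by simp [Fin.forall_fin_succ, *]) (by simp [Fin.forall_fin_succ, *])
      (by simp [Fin.sum_univ_three]; linarith) (fun u hu => by
        simp only [Fin.prod_univ_three, Matrix.cons_val]
        have : (u + x₁) * (u + x₂) * (u + s) - (u + y₁) * (u + y₂) * (u + 1)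
            = l * s * b ^ 2 * (u / 2 + (1 - s / 2)) := by
          linear_combination (u * (u + s)) * hxa + (u + s) * hxm - (u * (u + 1)) * hya
            - (u + 1) * hym
        have : 0 < l * s * b ^ 2 * (u / 2 + (1 - s / 2)) := mul_pos hc (by linarith)
        linarith)
    simp only [Fin.sum_univ_three, Matrix.cons_val, negMulLog_one] at key
    linarith
  · rw [apply_add_apply_eq_of_add_eq_of_mul_eq negMulLog hxa
        (by linear_combination hxm - h / 2),
      apply_add_apply_eq_of_add_eq_of_mul_eq negMulLog hya
        (by linear_combination hym - h), negMulLog_one]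
    ring

end RealAnalysis

open Polynomial in
theorem sum_map_roots_X_pow_mul_prod {κ : Type*} [Fintype κ] {f : ℝ → ℝ} (hf : f 0 = 0)
    (s : κ → ℝ) (k : ℕ) :
    ((X ^ k * ∏ i, (X - C (s i : ℂ))).roots.map fun z => f z.re).sum = ∑ i, f (s i) := by
  have hne : ∏ i, (X - C (s i : ℂ)) ≠ 0 := (monic_prod_X_sub_C _ Finset.univ).ne_zero
  rw [roots_mul (mul_ne_zero (pow_ne_zero _ X_ne_zero) hne), roots_prod _ _ hne]
  simp [Multiset.nsmul_singleton, hf]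

open Polynomial in
theorem entropy_mul_diagonal_mul_conjTranspose {n ι κ : Type*} [Fintype n] [DecidableEq n]
    [Fintype ι] [DecidableEq ι] [Fintype κ] (V : Matrix n ι ℂ) (w : ι → ℝ) (r : κ → ℝ)
    (hdet : ∀ z : ℂ, (Matrix.scalar ι z - diagonal (fun i => (w i : ℂ)) * (Vᴴ * V)).det =
      ∏ k, (z - r k)) :
    entropy (V * diagonal (fun i => (w i : ℂ)) * Vᴴ) = ∑ k, Real.negMulLog (r k) := by
  have hD : (diagonal fun i => (w i : ℂ)).IsHermitian := by
    rw [Matrix.isHermitian_diagonal_iff]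
    intro i
    simp [isSelfAdjoint_iff]
  have hH : (V * diagonal (fun i => (w i : ℂ)) * Vᴴ).IsHermitian :=
    isHermitian_mul_mul_conjTranspose V hD
  have hρ : (V * diagonal (fun i => (w i : ℂ)) * Vᴴ).charpoly =
      ∏ i, (X - C (hH.eigenvalues i : ℂ)) := hH.charpoly_eq
  have hG : (diagonal (fun i => (w i : ℂ)) * Vᴴ * V).charpoly = ∏ k, (X - C (r k : ℂ)) :=
    Polynomial.funext fun z => by
      rw [eval_charpoly, Matrix.mul_assoc, hdet, eval_prod]
      simp
  have hcomm := charpoly_mul_comm' V (diagonal (fun i => (w i : ℂ)) * Vᴴ)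
  rw [hG, ← Matrix.mul_assoc, hρ] at hcomm
  rw [entropy, dif_pos hH, ← sum_map_roots_X_pow_mul_prod (f := Real.negMulLog) (by simp) r
    (Fintype.card n), ← hcomm,
    sum_map_roots_X_pow_mul_prod (f := Real.negMulLog) (by simp) hH.eigenvalues]
  simp [Real.negMulLog]

/-- The columns are `√2 |ψ¹_A 2_B⟩`, `√2 |ψ¹_A 3_B⟩` and `|ψ²_AB⟩`. -/
def vecsAB (b β : ℝ) : Matrix (Fin 2 × Fin 4) (Fin 3) ℂ :=
  Matrix.of fun x => ![if x.2 = 2 then 1 else 0, if x.2 = 3 then 1 else 0, psi2 b β x]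

/-- The columns are `√2 |ψ¹_A 2_C⟩`, `√2 |ψ¹_A 3_C⟩` and `|i_A j_C⟩` for `i, j ∈ {0, 1}`. -/
def vecsAC : Matrix (Fin 2 × Fin 4) (Fin 6) ℂ :=
  Matrix.of fun x => ![if x.2 = 2 then 1 else 0, if x.2 = 3 then 1 else 0,
    if x = (0, 0) then 1 else 0, if x = (0, 1) then 1 else 0,
    if x = (1, 0) then 1 else 0, if x = (1, 1) then 1 else 0]

/-- The columns are `|2⟩`, `|3⟩`, `|0⟩` and `|φ_B⟩`. -/
def vecsB (b : ℝ) : Matrix (Fin 4) (Fin 4) ℂ :=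
  Matrix.of fun x => ![if x = 2 then 1 else 0, if x = 3 then 1 else 0,
    if x = 0 then 1 else 0, phiB b x]

theorem ofReal_sqrt_mul_self {x : ℝ} (hx : 0 ≤ x) : ((√x : ℝ) : ℂ) * (√x : ℝ) = x := by
  rw [← Complex.ofReal_mul, Real.mul_self_sqrt hx]

theorem inv_sqrt_two_mul_self : ((√2 : ℝ) : ℂ)⁻¹ * ((√2 : ℝ) : ℂ)⁻¹ = 1 / 2 := by
  rw [← mul_inv, ofReal_sqrt_mul_self (by norm_num)]; norm_num

theorem margAB_exampleRho (l b β : ℝ) :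
    margAB (exampleRho l b β) =
      vecsAB b β * diagonal (fun k => ((![l / 4, (1 - l) / 4, 1 / 2] k : ℝ) : ℂ)) *
        (vecsAB b β)ᴴ := by
  ext ⟨a, i⟩ ⟨a', j⟩
  simp [margAB, exampleRho, vecsAB, Matrix.mul_apply, Fin.sum_univ_succ, pureSt, vecMulVec_apply,
    psi1, rho1BC, rho2C, inv_sqrt_two_mul_self]
  fin_cases i <;> fin_cases j <;> simp <;> ring

theorem margAC_exampleRho {l b β : ℝ} (hb : b ^ 2 ≤ 1) (hβ : β ^ 2 ≤ 1) :
    margAC (exampleRho l b β) =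
      vecsAC * diagonal (fun k => ((![l / 4, (1 - l) / 4, (1 - β ^ 2) / 4, (1 - β ^ 2) / 4,
        β ^ 2 / 4, β ^ 2 / 4] k : ℝ) : ℂ)) * vecsACᴴ := by
  have ha := ofReal_sqrt_mul_self (sub_nonneg.mpr hb)
  have hα := ofReal_sqrt_mul_self (sub_nonneg.mpr hβ)
  push_cast at ha hα
  ext ⟨a, i⟩ ⟨a', j⟩
  simp [margAC, exampleRho, vecsAC, Matrix.mul_apply, Fin.sum_univ_succ, pureSt, vecMulVec_apply,
    psi1, psi2, phiB, rho1BC, rho2C, inv_sqrt_two_mul_self]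
  fin_cases a <;> fin_cases a' <;> fin_cases i <;> fin_cases j <;> simp <;>
    first | ring1 | linear_combination hα / 4 | linear_combination (β : ℂ) ^ 2 * ha / 4

theorem margB_exampleRho {l b β : ℝ} (hβ : β ^ 2 ≤ 1) :
    margB (exampleRho l b β) =
      vecsB b * diagonal (fun k => ((![l / 2, (1 - l) / 2, (1 - β ^ 2) / 2,
        β ^ 2 / 2] k : ℝ) : ℂ)) * (vecsB b)ᴴ := by
  have hα := ofReal_sqrt_mul_self (sub_nonneg.mpr hβ)
  push_cast at hα
  ext i j
  simp [margB, exampleRho, vecsB, Matrix.mul_apply, Fin.sum_univ_succ, pureSt, vecMulVec_apply,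
    psi1, psi2, phiB, rho1BC, rho2C, inv_sqrt_two_mul_self]
  fin_cases i <;> fin_cases j <;> simp <;>
    first | ring1 | linear_combination hα / 2

theorem margC_exampleRho {l b β : ℝ} (hb : b ^ 2 ≤ 1) (hβ : β ^ 2 ≤ 1) :
    margC (exampleRho l b β) =
      (1 : Matrix (Fin 4) (Fin 4) ℂ) *
        diagonal (fun k => ((![1 / 4, 1 / 4, l / 2, (1 - l) / 2] k : ℝ) : ℂ)) *
        (1 : Matrix (Fin 4) (Fin 4) ℂ)ᴴ := by
  have ha := ofReal_sqrt_mul_self (sub_nonneg.mpr hb)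
  have hα := ofReal_sqrt_mul_self (sub_nonneg.mpr hβ)
  push_cast at ha hα
  rw [conjTranspose_one, Matrix.one_mul, Matrix.mul_one]
  ext i j
  simp [margC, exampleRho, Fin.sum_univ_succ, pureSt, vecMulVec_apply,
    psi1, psi2, phiB, rho1BC, rho2C, inv_sqrt_two_mul_self]
  fin_cases i <;> fin_cases j <;> simp <;>
    first | ring1 | linear_combination hα / 4 + (β : ℂ) ^ 2 * ha / 4

theorem entropy_margAB_exampleRho {l b β x₁ x₂ : ℝ} (hb : b ^ 2 ≤ 1) (hβ : β ^ 2 ≤ 1)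
    (hxa : x₁ + x₂ = 1 + l) (hxm : x₁ * x₂ = l * (1 - β ^ 2 * b ^ 2 / 2)) :
    entropy (margAB (exampleRho l b β)) =
      Real.negMulLog ((1 - l) / 2) + Real.negMulLog (x₁ / 2) + Real.negMulLog (x₂ / 2) := by
  have ha := ofReal_sqrt_mul_self (sub_nonneg.mpr hb)
  have hα := ofReal_sqrt_mul_self (sub_nonneg.mpr hβ)
  have hxa' := congrArg (fun x : ℝ => (x : ℂ)) hxa
  have hxm' := congrArg (fun x : ℝ => (x : ℂ)) hxm
  push_cast at ha hα hxa' hxm'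
  rw [margAB_exampleRho, entropy_mul_diagonal_mul_conjTranspose _ _
    ![(1 - l) / 2, x₁ / 2, x₂ / 2] fun z => ?_, Fin.sum_univ_three]
  · simp
  · simp [det_fin_three, Fin.prod_univ_three, vecsAB, Matrix.mul_apply, Fin.sum_univ_succ,
      Fintype.sum_prod_type, psi2, phiB]
    linear_combination (z - (1 - l) / 2) * (z / 2 * hxa' - hxm' / 4
      - (z - l / 2) / 2 * (hα + (β : ℂ) ^ 2 * ha))

theorem entropy_margAC_exampleRho {l b β : ℝ} (hb : b ^ 2 ≤ 1) (hβ : β ^ 2 ≤ 1) :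
    entropy (margAC (exampleRho l b β)) =
      Real.negMulLog (l / 2) + Real.negMulLog ((1 - l) / 2) +
        2 * Real.negMulLog ((1 - β ^ 2) / 4) + 2 * Real.negMulLog (β ^ 2 / 4) := by
  have hgram : vecsACᴴ * vecsAC = diagonal ![2, 2, 1, 1, 1, 1] := by
    ext i j
    fin_cases i <;> fin_cases j <;>
      simp [vecsAC, Matrix.mul_apply, Fintype.sum_prod_type]
  rw [margAC_exampleRho hb hβ, entropy_mul_diagonal_mul_conjTranspose _ _
    ![l / 2, (1 - l) / 2, (1 - β ^ 2) / 4, (1 - β ^ 2) / 4, β ^ 2 / 4, β ^ 2 / 4] fun z => ?_]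
  · simp [Fin.sum_univ_succ]
    ring
  · rw [hgram, diagonal_mul_diagonal, scalar_apply, diagonal_sub, det_diagonal]
    simp [Fin.prod_univ_succ]
    ring

theorem entropy_margB_exampleRho {l b β y₁ y₂ : ℝ} (hb : b ^ 2 ≤ 1) (hβ : β ^ 2 ≤ 1)
    (hya : y₁ + y₂ = l + β ^ 2) (hym : y₁ * y₂ = l * β ^ 2 * (1 - b ^ 2)) :
    entropy (margB (exampleRho l b β)) =
      Real.negMulLog ((1 - l) / 2) + Real.negMulLog ((1 - β ^ 2) / 2) +
        Real.negMulLog (y₁ / 2) + Real.negMulLog (y₂ / 2) := by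
  have ha := ofReal_sqrt_mul_self (sub_nonneg.mpr hb)
  have hya' := congrArg (fun x : ℝ => (x : ℂ)) hya
  have hym' := congrArg (fun x : ℝ => (x : ℂ)) hym
  push_cast at ha hya' hym'
  rw [margB_exampleRho hβ, entropy_mul_diagonal_mul_conjTranspose _ _
    ![(1 - l) / 2, (1 - β ^ 2) / 2, y₁ / 2, y₂ / 2] fun z => ?_, Fin.sum_univ_four]
  · simp
  · simp [det_succ_row_zero, Fin.prod_univ_four, vecsB, Matrix.mul_apply, Fin.sum_univ_succ,
      phiB, submatrix, Fin.succAbove]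
    linear_combination (z - (1 - l) / 2) * (z - (1 - (β : ℂ) ^ 2) / 2) * (z / 2 * hya' - hym' / 4
      - (z - l / 2) / 2 * (β : ℂ) ^ 2 * ha)

theorem entropy_margC_exampleRho {l b β : ℝ} (hb : b ^ 2 ≤ 1) (hβ : β ^ 2 ≤ 1) :
    entropy (margC (exampleRho l b β)) =
      2 * Real.negMulLog (1 / 4) + Real.negMulLog (l / 2) + Real.negMulLog ((1 - l) / 2) := by
  rw [margC_exampleRho hb hβ, entropy_mul_diagonal_mul_conjTranspose _ _
    ![1 / 4, 1 / 4, l / 2, (1 - l) / 2] fun z => ?_, Fin.sum_univ_four]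
  · simp
    ring
  · rw [conjTranspose_one, Matrix.one_mul, Matrix.mul_one, scalar_apply, diagonal_sub,
      det_diagonal]

/-- for the explicit family `ρ_ABC` above with parameters
`λ₁, b, β₂ ∈ [0,1]`, one has `T^(a)(ρ_ABC) = 0` iff `λ₁ · b · β₂ = 0`. -/
theorem Ta_exampleRho_eq_zero_iff (lam₁ b β₂ : ℝ)
    (hlam₁ : 0 ≤ lam₁ ∧ lam₁ ≤ 1) (hb : 0 ≤ b ∧ b ≤ 1) (hβ₂ : 0 ≤ β₂ ∧ β₂ ≤ 1) :
    Ta (exampleRho lam₁ b β₂) = 0 ↔ lam₁ * b * β₂ = 0 := by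
  have hb2 : b ^ 2 ≤ 1 := pow_le_one₀ hb.1 hb.2
  have hβ2 : β₂ ^ 2 ≤ 1 := pow_le_one₀ hβ₂.1 hβ₂.2
  have hl := hlam₁.1
  have hs := sq_nonneg β₂
  have hsb : β₂ ^ 2 * b ^ 2 ≤ 1 := mul_le_one₀ hβ2 (sq_nonneg b) hb2
  obtain ⟨x₁, x₂, hx₁, hx₂, hxa, hxm⟩ := exists_nonneg_add_eq_mul_eq (t := 1 + lam₁)
    (d := lam₁ * (1 - β₂ ^ 2 * b ^ 2 / 2)) (by linarith) (mul_nonneg hl (by linarith))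
    (by linarith [sq_nonneg (1 - lam₁), mul_nonneg hl (mul_nonneg hs (sq_nonneg b))])
  obtain ⟨y₁, y₂, hy₁, hy₂, hya, hym⟩ := exists_nonneg_add_eq_mul_eq (t := lam₁ + β₂ ^ 2)
    (d := lam₁ * β₂ ^ 2 * (1 - b ^ 2)) (by linarith)
    (mul_nonneg (mul_nonneg hl hs) (by linarith))
    (by linarith [sq_nonneg (lam₁ - β₂ ^ 2), mul_nonneg hl (mul_nonneg hs (sq_nonneg b))])
  have hiff := entropy_balance_iff hl hs hβ2 hx₁ hx₂ hy₁ hy₂ hxa hxm hya hym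
  have hTa : Ta (exampleRho lam₁ b β₂) = (Real.negMulLog x₁ + Real.negMulLog x₂ +
      Real.negMulLog (β₂ ^ 2) - (Real.negMulLog y₁ + Real.negMulLog y₂)) / 2 := by
    have h4 (x : ℝ) : Real.negMulLog (x / 4) = Real.negMulLog (x / 2 / 2) := by
      rw [div_div]; norm_num
    rw [Ta, entropy_margAB_exampleRho hb2 hβ2 hxa hxm, entropy_margAC_exampleRho hb2 hβ2,
      entropy_margB_exampleRho hb2 hβ2 hya hym, entropy_margC_exampleRho hb2 hβ2]
    simp only [h4, negMulLog_div_two, Real.negMulLog_one]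
    linear_combination (Real.log 2 / 2) * (hxa - hya)
  rw [hTa, div_eq_zero_iff, or_iff_left two_ne_zero, hiff]
  simp [or_comm, or_left_comm]

end
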